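/- arXiv:2510.09648 — 2 statements merged into one kernel-verified Lean document; each statement's English description precedes it below -/
import Mathlib

section
/- Let U ⊆ ℝⁿ be open, let g₁,…,gₙ : U → ℝ be positive differentiable functions, and let t ∈ [0,1]. For s ∈ [0,1] let Γ^k_{ij}(g^s) denote the Christoffel symbols of the diagonal metric g^s with components δ_{ij} gᵢ^s, computed by the formula Γ^k_{ij}(g^s) = ½ (g^s_{kk})⁻¹ (∂ᵢ g^s_{jk} + ∂ⱼ g^s_{ik} − ∂ₖ g^s_{ij}). Then for all indices i, j, k with the property that at most two of i, j, k coincide in the pattern (i.e., for every i,j,k except the case Γ^k_{ii} with k ≠ i one has exact equality, and in that remaining case equality of the logarithmic-derivative factor), the symbols of the form Γ^k_{ij}(g^t) with k ∈ {i,j} satisfy Γ^k_{ij}(g^t) = t · Γ^k_{ij}(g^1): the Christoffel symbols Γ^i_{ij}, Γ^j_{ij}, and Γ^i_{ii} of g^t equal t times the corresponding Christoffel symbols of g = g^1. -/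
open scoped Real

/-- Partial derivative `∂ᵢ f` at `x`: the Fréchet derivative in the direction of
the `i`-th standard basis vector. -/
noncomputable def pd {n : ℕ} (i : Fin n) (f : EuclideanSpace ℝ (Fin n) → ℝ)
    (x : EuclideanSpace ℝ (Fin n)) : ℝ :=
  fderiv ℝ f x (EuclideanSpace.single i 1)

/-- Components of the diagonal metric `g^t`: `g^t_{ij} = δ_{ij} gᵢ^t`
(real power `t` of `gᵢ`). -/
noncomputable def gtComp {n : ℕ} (g : Fin n → EuclideanSpace ℝ (Fin n) → ℝ)
    (t : ℝ) (i j : Fin n) (x : EuclideanSpace ℝ (Fin n)) : ℝ :=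
  if i = j then (g i x) ^ t else 0

/-- Levi-Civita Christoffel symbols of the diagonal metric `g^t`:
`Γ^k_{ij}(g^t) = ½ (g^t_{kk})⁻¹ (∂ᵢ g^t_{jk} + ∂ⱼ g^t_{ik} − ∂ₖ g^t_{ij})`. -/
noncomputable def christoffel {n : ℕ} (g : Fin n → EuclideanSpace ℝ (Fin n) → ℝ)
    (t : ℝ) (k i j : Fin n) (x : EuclideanSpace ℝ (Fin n)) : ℝ :=
  (1 / 2) * (gtComp g t k k x)⁻¹ *
    (pd i (gtComp g t j k) x + pd j (gtComp g t i k) x - pd k (gtComp g t i j) x)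

theorem gtComp_comm {n : ℕ} (g : Fin n → EuclideanSpace ℝ (Fin n) → ℝ) (t : ℝ) (i j : Fin n) :
    gtComp g t i j = gtComp g t j i := by
  funext x
  by_cases h : i = j
  · rw [h]
  · simp [gtComp, h, Ne.symm h]

theorem christoffel_comm {n : ℕ} (g : Fin n → EuclideanSpace ℝ (Fin n) → ℝ) (t : ℝ)
    (k i j : Fin n) (x : EuclideanSpace ℝ (Fin n)) :
    christoffel g t k i j x = christoffel g t k j i x := by
  simp only [christoffel, gtComp_comm g t i j]
  ring

theorem pd_gtComp_self {n : ℕ} {g : Fin n → EuclideanSpace ℝ (Fin n) → ℝ} {k : Fin n}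
    {x : EuclideanSpace ℝ (Fin n)} (hd : DifferentiableAt ℝ (g k) x) (hx : g k x ≠ 0)
    (t : ℝ) (l : Fin n) :
    pd l (gtComp g t k k) x = t * g k x ^ (t - 1) * pd l (g k) x := by
  have hfun : gtComp g t k k = fun y => g k y ^ t := by
    funext y
    simp [gtComp]
  simp [pd, hfun, (hd.hasFDerivAt.rpow_const (p := t) (Or.inl hx)).fderiv]

/-- The symbol `Γ^k_{kj}(g^t)` is `t` times half the logarithmic derivative `∂ⱼ log gₖ`. -/
theorem christoffel_self_left {n : ℕ} {g : Fin n → EuclideanSpace ℝ (Fin n) → ℝ} {k : Fin n}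
    {x : EuclideanSpace ℝ (Fin n)} (hd : DifferentiableAt ℝ (g k) x) (hx : 0 < g k x)
    (t : ℝ) (j : Fin n) :
    christoffel g t k k j x = t * ((1 / 2) * (g k x)⁻¹ * pd j (g k) x) := by
  have hpow : g k x ^ t ≠ 0 := (Real.rpow_pos_of_pos hx t).ne'
  have hself : gtComp g t k k x = g k x ^ t := by simp [gtComp]
  rw [christoffel, gtComp_comm g t j k, pd_gtComp_self hd hx.ne', hself,
    Real.rpow_sub_one hx.ne']
  field_simp
  ring

/-- the Christoffel symbols `Γ^k_{ij}(g^t)` with `k ∈ {i, j}`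
(i.e. the symbols `Γ^i_{ij}`, `Γ^j_{ij}`, and `Γ^i_{ii}`) equal `t` times the
corresponding Christoffel symbols of `g = g^1`. -/
theorem christoffel_scales (n : ℕ) (hn : 1 ≤ n)
    (U : Set (EuclideanSpace ℝ (Fin n))) (hU : IsOpen U)
    (g : Fin n → EuclideanSpace ℝ (Fin n) → ℝ)
    (hg_pos : ∀ i, ∀ y ∈ U, 0 < g i y)
    (hg_diff : ∀ i, DifferentiableOn ℝ (g i) U)
    (t : ℝ) (ht : t ∈ Set.Icc (0 : ℝ) 1)
    (x : EuclideanSpace ℝ (Fin n)) (hx : x ∈ U)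
    (i j k : Fin n) (hk : k = i ∨ k = j) :
    christoffel g t k i j x = t * christoffel g 1 k i j x := by
  have hd : DifferentiableAt ℝ (g k) x := (hg_diff k).differentiableAt (hU.mem_nhds hx)
  have hpos := hg_pos k x hx
  rcases hk with rfl | rfl
  · simp only [christoffel_self_left hd hpos, one_mul]
  · simp only [christoffel_comm g _ k i k, christoffel_self_left hd hpos, one_mul]
end

section
/- Let Ω, A be real 2×2 matrices with A invertible, det A > 0, Ω skew-symmetric (Ωᵀ = −Ω), and A⁻¹ Ω A also skew-symmetric. Then the Pfaffians agree: (A⁻¹ Ω A)₀₁ = Ω₀₁ (for a 2×2 skew matrix [[0,a],[−a,0]] the Pfaffian is the (0,1) entry a). -/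
open Matrix

/-- conjugation invariance of the Pfaffian of a 2×2 skew-symmetric
matrix. If `A` is invertible with `det A > 0`, `Ω` is skew-symmetric, and
`A⁻¹ Ω A` is also skew-symmetric, then their Pfaffians (the `(0,1)` entries)
agree: `(A⁻¹ Ω A) 0 1 = Ω 0 1`. -/
theorem pfaffian_conjugation_invariant
    (Ω A : Matrix (Fin 2) (Fin 2) ℝ)
    (hA : IsUnit A) (hdet : 0 < A.det)
    (hΩ : Ωᵀ = -Ω)
    (hconj : (A⁻¹ * Ω * A)ᵀ = -(A⁻¹ * Ω * A)) :
    (A⁻¹ * Ω * A) 0 1 = Ω 0 1 := by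
  have hAB : A * (A⁻¹ * Ω * A) = Ω * A := by
    rw [Matrix.mul_assoc, Matrix.mul_nonsing_inv_cancel_left _ _ ((isUnit_iff_isUnit_det A).1 hA)]
  generalize A⁻¹ * Ω * A = B at *
  have skew {M : Matrix (Fin 2) (Fin 2) ℝ} (hM : Mᵀ = -M) :
      M 0 0 = 0 ∧ M 1 1 = 0 ∧ M 1 0 = -M 0 1 := by
    have entry (i j : Fin 2) : M j i = -M i j := congrFun (congrFun hM i) j
    exact ⟨by linarith [entry 0 0], by linarith [entry 1 1], entry 0 1⟩
  obtain ⟨hΩ₀, hΩ₁, hΩ₂⟩ := skew hΩ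
  obtain ⟨hB₀, hB₁, hB₂⟩ := skew hconj
  have entry (i j : Fin 2) : (A * B) i j = (Ω * A) i j := by rw [hAB]
  simp only [Matrix.mul_apply, Fin.sum_univ_two] at entry
  have h₀₀ := entry 0 0
  have h₀₁ := entry 0 1
  have h₁₀ := entry 1 0
  have h₁₁ := entry 1 1
  simp only [hΩ₀, hΩ₁, hΩ₂, hB₀, hB₁, hB₂] at h₀₀ h₀₁ h₁₀ h₁₁
  by_contra hne
  have hne' : B 0 1 - Ω 0 1 ≠ 0 := sub_ne_zero.2 hne
  have htrace : A 0 0 + A 1 1 = 0 := mul_left_cancel₀ hne' (by linarith)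
  have hsymm : A 0 1 - A 1 0 = 0 := mul_left_cancel₀ hne' (by linarith)
  rw [det_fin_two, eq_neg_of_add_eq_zero_left htrace, sub_eq_zero.1 hsymm] at hdet
  nlinarith [sq_nonneg (A 1 1), sq_nonneg (A 1 0)]
end
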